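/- Let F : ℝ^d → [0,∞) be differentiable with Lipschitz gradient, let G : ℝ^d → [0,∞) be locally bounded and weakly convex with modulus ρ_G > 0, and assume either G is Lipschitz continuous or ∫ exp(−G(x)) dx < ∞. Fix t_max ∈ (0, 1/ρ_G), set U^t = F + M_G^t (with U^0 = F + G), Z_t = ∫ exp(−U^t(x)) dx, π^t(x) = exp(−U^t(x))/Z_t, φ(s) = sup{‖p‖ : p ∈ ∂G(prox_{tG}(x)), ‖x‖ ≤ s, 0 < t ≤ t_max}, and assume K_max := ∫ φ(‖x‖)² exp(−U^{t_max}(x)) dx < ∞. Then the curve t ↦ π^t is Lipschitz continuous on [0, t_max) in L¹: for all s, t ∈ [0, t_max), ∫ |π^s(x) − π^t(x)| dx ≤ (K_max/(2 Z_0)) (1 + Z_{t_max}/Z_0) |s−t|. -/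

import Mathlib

noncomputable section

open MeasureTheory
open scoped RealInnerProductSpace

variable {d : ℕ}

/-- Moreau envelope `M_G^t(x) = inf_y G(y) + ‖x-y‖²/(2t)` (with `M_G^0 := G`). -/
noncomputable def moreau (G : EuclideanSpace ℝ (Fin d) → ℝ) (t : ℝ)
    (x : EuclideanSpace ℝ (Fin d)) : ℝ :=
  if t = 0 then G x else ⨅ y : EuclideanSpace ℝ (Fin d), (G y + ‖x - y‖ ^ 2 / (2 * t))

/-- Proximal map `prox_{tG}(x)` as the set of minimizers of `y ↦ G(y) + ‖x-y‖²/(2t)`. -/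
def proxSet (G : EuclideanSpace ℝ (Fin d) → ℝ) (t : ℝ)
    (x : EuclideanSpace ℝ (Fin d)) : Set (EuclideanSpace ℝ (Fin d)) :=
  {p | ∀ y, G p + ‖x - p‖ ^ 2 / (2 * t) ≤ G y + ‖x - y‖ ^ 2 / (2 * t)}

/-- `G` is locally bounded: bounded above on a neighborhood of every point. -/
def LocBdd (G : EuclideanSpace ℝ (Fin d) → ℝ) : Prop :=
  ∀ x : EuclideanSpace ℝ (Fin d), ∃ U ∈ nhds x, BddAbove (G '' U)

/-- Regular (Fréchet) subdifferential. -/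
def regSubdiff (G : EuclideanSpace ℝ (Fin d) → ℝ) (x : EuclideanSpace ℝ (Fin d)) :
    Set (EuclideanSpace ℝ (Fin d)) :=
  {v | ∀ ε > 0, ∀ᶠ y in nhdsWithin x {x}ᶜ,
    -(ε * ‖y - x‖) ≤ G y - G x - ⟪v, y - x⟫}

/-- Normalization constant `Z_u = ∫ exp(−F(x) − M_G^u(x)) dx`. -/
noncomputable def Zfun (F G : EuclideanSpace ℝ (Fin d) → ℝ) (u : ℝ) : ℝ :=
  ∫ x : EuclideanSpace ℝ (Fin d), Real.exp (-(F x + moreau G u x))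

/-- The density `π^u(x) = exp(−F(x) − M_G^u(x))/Z_u`. -/
noncomputable def piDen (F G : EuclideanSpace ℝ (Fin d) → ℝ) (u : ℝ)
    (x : EuclideanSpace ℝ (Fin d)) : ℝ :=
  Real.exp (-(F x + moreau G u x)) / Zfun F G u

open Filter Topology in
theorem aux_exists_prox (G : EuclideanSpace ℝ (Fin d) → ℝ) (hG0 : ∀ x, 0 ≤ G x)
    (hc : Continuous G) (t : ℝ) (ht : 0 < t) (x : EuclideanSpace ℝ (Fin d)) :
    ∃ p, p ∈ proxSet G t x := by
  have hcont : Continuous (fun y => G y + ‖x - y‖ ^ 2 / (2 * t)) := by fun_prop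
  apply hcont.exists_forall_le
  have h1 : Tendsto (fun y : EuclideanSpace ℝ (Fin d) => ‖x - y‖) (cocompact _) atTop := by
    have := tendsto_dist_left_cocompact_atTop x
    exact this.congr (fun y => dist_eq_norm x y)
  have h2 : Tendsto (fun y : EuclideanSpace ℝ (Fin d) => ‖x - y‖ ^ 2 / (2 * t))
      (cocompact _) atTop :=
    ((tendsto_pow_atTop two_ne_zero).comp h1).atTop_div_const (by positivity)
  exact tendsto_atTop_mono (fun y => by linarith [hG0 y]) h2

theorem aux_moreau_le (G : EuclideanSpace ℝ (Fin d) → ℝ) (hG0 : ∀ x, 0 ≤ G x)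
    (t : ℝ) (ht : 0 < t) (x y : EuclideanSpace ℝ (Fin d)) :
    moreau G t x ≤ G y + ‖x - y‖ ^ 2 / (2 * t) := by
  unfold moreau
  rw [if_neg ht.ne']
  refine ciInf_le ⟨0, ?_⟩ y
  rintro _ ⟨z, rfl⟩
  have := hG0 z
  positivity

theorem aux_moreau_eq (G : EuclideanSpace ℝ (Fin d) → ℝ) (hG0 : ∀ x, 0 ≤ G x)
    (t : ℝ) (ht : 0 < t) (x p : EuclideanSpace ℝ (Fin d)) (hp : p ∈ proxSet G t x) :
    moreau G t x = G p + ‖x - p‖ ^ 2 / (2 * t) := by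
  apply le_antisymm (aux_moreau_le G hG0 t ht x p)
  unfold moreau
  rw [if_neg ht.ne']
  exact le_ciInf hp

theorem aux_moreau_anti (G : EuclideanSpace ℝ (Fin d) → ℝ) (hG0 : ∀ x, 0 ≤ G x)
    (hc : Continuous G) (s t : ℝ) (hs : 0 ≤ s) (hst : s ≤ t) (x : EuclideanSpace ℝ (Fin d)) :
    moreau G t x ≤ moreau G s x := by
  rcases hst.eq_or_lt with rfl | hlt
  · exact le_rfl
  have ht : 0 < t := hs.trans_lt hlt
  rcases hs.eq_or_lt with rfl | hs'
  · have := aux_moreau_le G hG0 t ht x x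
    simpa [moreau] using this
  · obtain ⟨p, hp⟩ := aux_exists_prox G hG0 hc s hs' x
    rw [aux_moreau_eq G hG0 s hs' x p hp]
    refine (aux_moreau_le G hG0 t ht x p).trans ?_
    gcongr

open Filter Topology in
theorem aux_subgrad (G : EuclideanSpace ℝ (Fin d) → ℝ)
    (t : ℝ) (ht : 0 < t) (x p : EuclideanSpace ℝ (Fin d)) (hp : p ∈ proxSet G t x) :
    (1 / t) • (x - p) ∈ regSubdiff G p := by
  intro ε hε
  have hev : ∀ᶠ y in 𝓝 p, ‖y - p‖ < 2 * t * ε := by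
    have : Metric.ball p (2 * t * ε) ∈ 𝓝 p := Metric.ball_mem_nhds _ (by positivity)
    filter_upwards [this] with y hy
    simpa [dist_eq_norm] using hy
  filter_upwards [nhdsWithin_le_nhds hev] with y hy
  have h := hp y
  have e : x - y = (x - p) - (y - p) := by abel
  rw [e, norm_sub_sq_real (x - p) (y - p)] at h
  rw [real_inner_smul_left]
  set a := ‖y - p‖
  set i := ⟪x - p, y - p⟫
  have ha : 0 ≤ a := norm_nonneg _
  have h2 : a ^ 2 / (2 * t) ≤ ε * a := by
    rw [div_le_iff₀ (by positivity)]
    nlinarith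
  have h3 : (‖x - p‖ ^ 2 - 2 * i + a ^ 2) / (2 * t)
      = ‖x - p‖ ^ 2 / (2 * t) - 1 / t * i + a ^ 2 / (2 * t) := by
    field_simp
  linarith

theorem aux_step (G : EuclideanSpace ℝ (Fin d) → ℝ) (hG0 : ∀ x, 0 ≤ G x)
    (s t : ℝ) (hs : 0 < s) (hst : s ≤ t)
    (x p : EuclideanSpace ℝ (Fin d)) (C : ℝ) (hp : p ∈ proxSet G t x)
    (hC : ‖(1 / t) • (x - p)‖ ≤ C) :
    moreau G s x - moreau G t x ≤ C ^ 2 / 2 * (t / s) * (t - s) := by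
  have ht : 0 < t := hs.trans_le hst
  have h1 := aux_moreau_le G hG0 s hs x p
  rw [aux_moreau_eq G hG0 t ht x p hp]
  rw [norm_smul, Real.norm_of_nonneg (by positivity)] at hC
  have hn : ‖x - p‖ = t * (1 / t * ‖x - p‖) := by field_simp
  set a := 1 / t * ‖x - p‖ with ha
  have ha0 : 0 ≤ a := by positivity
  rw [hn] at h1 ⊢
  have h2 : (t * a) ^ 2 / (2 * s) - (t * a) ^ 2 / (2 * t) = a ^ 2 / 2 * (t / s) * (t - s) := by
    field_simp
  have h3 : a ^ 2 / 2 * (t / s) * (t - s) ≤ C ^ 2 / 2 * (t / s) * (t - s) := by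
    have : 0 ≤ t - s := by linarith
    gcongr
  linarith

open Filter Topology in
theorem aux_lip_pos (G : EuclideanSpace ℝ (Fin d) → ℝ) (hG0 : ∀ x, 0 ≤ G x)
    (hc : Continuous G) (tmax : ℝ) (x : EuclideanSpace ℝ (Fin d)) (C : ℝ)
    (hC : ∀ t p, 0 < t → t ≤ tmax → p ∈ proxSet G t x → ‖(1 / t) • (x - p)‖ ≤ C)
    (s t : ℝ) (hs : 0 < s) (hst : s ≤ t) (ht : t ≤ tmax) :
    moreau G s x - moreau G t x ≤ C ^ 2 / 2 * (t - s) := by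
  have key : ∀ n : ℕ, moreau G s x - moreau G t x ≤
      C ^ 2 / 2 * (1 + ((t - s) / s) * (1 / ((n : ℝ) + 1))) * (t - s) := by
    intro n
    set h := (t - s) / ((n : ℝ) + 1) with hh
    have hn : (0 : ℝ) < (n : ℝ) + 1 := by positivity
    have hh0 : 0 ≤ h := div_nonneg (by linarith) hn.le
    have hmul : ((n : ℝ) + 1) * h = t - s := by rw [hh]; field_simp
    have ind : ∀ i : ℕ, i ≤ n + 1 → moreau G s x - moreau G (s + i * h) x ≤
        C ^ 2 / 2 * (1 + h / s) * (i * h) := by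
      intro i
      induction i with
      | zero => intro _; simp
      | succ k ih =>
        intro hk
        have ih := ih (by omega)
        have hk0 : 0 ≤ (k : ℝ) * h := by positivity
        have hb : s + ((k + 1 : ℕ) : ℝ) * h ≤ tmax := by
          have h5 : ((k + 1 : ℕ) : ℝ) ≤ (n : ℝ) + 1 := by exact_mod_cast hk
          have h6 := mul_le_mul_of_nonneg_right h5 hh0
          linarith
        push_cast at hb ⊢
        have hpos : 0 < s + ((k : ℝ) + 1) * h := by positivity
        obtain ⟨p, hp⟩ := aux_exists_prox G hG0 hc _ hpos x
        have h7 := aux_step G hG0 (s + k * h) (s + ((k : ℝ) + 1) * h) (by linarith)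
          (by linarith) x p C hp (hC _ _ hpos hb hp)
        have h8 : (s + ((k : ℝ) + 1) * h) / (s + k * h) ≤ 1 + h / s := by
          have : (s + ((k : ℝ) + 1) * h) / (s + k * h) = 1 + h / (s + k * h) := by
            have : s + k * h ≠ 0 := by linarith
            field_simp
            ring
          rw [this]
          gcongr
          linarith
        have h9 : s + ((k : ℝ) + 1) * h - (s + k * h) = h := by ring
        rw [h9] at h7
        have h10 : C ^ 2 / 2 * ((s + ((k : ℝ) + 1) * h) / (s + k * h)) * h
            ≤ C ^ 2 / 2 * (1 + h / s) * h := by gcongr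
        linarith
    have h11 := ind (n + 1) le_rfl
    push_cast at h11
    rw [hmul] at h11
    have e1 : s + (t - s) = t := by ring
    rw [e1] at h11
    have e2 : h / s = ((t - s) / s) * (1 / ((n : ℝ) + 1)) := by rw [hh]; field_simp
    rwa [e2] at h11
  have lim : Tendsto (fun n : ℕ => C ^ 2 / 2 * (1 + ((t - s) / s) * (1 / ((n : ℝ) + 1))) * (t - s))
      atTop (𝓝 (C ^ 2 / 2 * (1 + ((t - s) / s) * 0) * (t - s))) :=
    (((tendsto_one_div_add_atTop_nhds_zero_nat (𝕜 := ℝ)).const_mul _).const_add 1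
      |>.const_mul _).mul_const _
  have := ge_of_tendsto' lim key
  simpa using this

open Filter Topology in
theorem aux_lip (G : EuclideanSpace ℝ (Fin d) → ℝ) (hG0 : ∀ x, 0 ≤ G x)
    (hc : Continuous G) (tmax : ℝ) (x : EuclideanSpace ℝ (Fin d)) (C : ℝ)
    (hC : ∀ t p, 0 < t → t ≤ tmax → p ∈ proxSet G t x → ‖(1 / t) • (x - p)‖ ≤ C)
    (s t : ℝ) (hs : 0 ≤ s) (hst : s ≤ t) (ht : t ≤ tmax) :
    moreau G s x - moreau G t x ≤ C ^ 2 / 2 * (t - s) := by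
  rcases hs.eq_or_lt with rfl | hs'
  swap
  · exact aux_lip_pos G hG0 hc tmax x C hC s t hs' hst ht
  rcases hst.eq_or_lt with rfl | ht0
  · simp
  have hex : ∀ r : ℝ, ∃ p, 0 < r → p ∈ proxSet G r x := by
    intro r
    by_cases hr : 0 < r
    · obtain ⟨p, hp⟩ := aux_exists_prox G hG0 hc r hr x
      exact ⟨p, fun _ => hp⟩
    · exact ⟨0, fun h => absurd h hr⟩
  choose P hP using hex
  have hIoo : ∀ᶠ r in 𝓝[>] (0 : ℝ), r ∈ Set.Ioo 0 t := Ioo_mem_nhdsGT ht0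
  have hP0 : Tendsto P (𝓝[>] 0) (𝓝 x) := by
    rw [tendsto_iff_norm_sub_tendsto_zero]
    have hl : Tendsto (fun r : ℝ => r * C) (𝓝[>] 0) (𝓝 0) := by
      have : Tendsto (fun r : ℝ => r * C) (𝓝 0) (𝓝 (0 * C)) :=
        tendsto_id.mul_const C
      rw [zero_mul] at this
      exact this.mono_left nhdsWithin_le_nhds
    refine squeeze_zero' (Eventually.of_forall fun _ => norm_nonneg _) ?_ hl
    filter_upwards [hIoo] with r hr
    have h := hC r (P r) hr.1 (hr.2.le.trans ht) (hP r hr.1)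
    have hr0 : 0 < r := hr.1
    rw [norm_smul, Real.norm_of_nonneg (by positivity), norm_sub_rev] at h
    rw [one_div, inv_mul_le_iff₀ hr0] at h
    exact h
  have hG : Tendsto (fun r => G (P r)) (𝓝[>] 0) (𝓝 (G x)) := (hc.tendsto x).comp hP0
  have hR : Tendsto (fun r : ℝ => moreau G t x + C ^ 2 / 2 * (t - r)) (𝓝[>] 0)
      (𝓝 (moreau G t x + C ^ 2 / 2 * (t - 0))) := by
    have : Continuous (fun r : ℝ => moreau G t x + C ^ 2 / 2 * (t - r)) := by fun_prop
    exact (this.tendsto 0).mono_left nhdsWithin_le_nhds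
  have hle : G x ≤ moreau G t x + C ^ 2 / 2 * (t - 0) := by
    refine le_of_tendsto_of_tendsto hG hR ?_
    filter_upwards [hIoo] with r hr
    have h1 := aux_lip_pos G hG0 hc tmax x C hC r t hr.1 hr.2.le ht
    rw [aux_moreau_eq G hG0 r hr.1 x _ (hP r hr.1)] at h1
    have : 0 ≤ ‖x - P r‖ ^ 2 / (2 * r) := by
      have := hr.1
      positivity
    linarith
  have : moreau G 0 x = G x := by simp [moreau]
  rw [this]
  linarith

theorem aux_main {α : Type*} [MeasurableSpace α] (μ : Measure α) (f g k : α → ℝ) (δ Z0 Zm K : ℝ)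
    (hf : Integrable f μ) (hg : Integrable g μ) (hk : Integrable k μ)
    (hg0 : ∀ x, 0 ≤ g x) (hfg : ∀ x, f x ≤ g x)
    (hdiff : ∀ x, g x - f x ≤ k x / 2 * δ) (hK : ∫ x, k x ∂μ = K) (hK0 : 0 ≤ K) (hδ : 0 ≤ δ)
    (hZ0 : 0 < Z0) (hZf : Z0 ≤ ∫ x, f x ∂μ) (hZm : Z0 ≤ Zm) :
    ∫ x, |f x / (∫ y, f y ∂μ) - g x / (∫ y, g y ∂μ)| ∂μ ≤
      K / (2 * Z0) * (1 + Zm / Z0) * δ := by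
  set A := ∫ y, f y ∂μ with hA
  set B := ∫ y, g y ∂μ with hB
  have hA0 : 0 < A := hZ0.trans_le hZf
  have hAB : A ≤ B := integral_mono hf hg hfg
  have hB0 : 0 < B := hA0.trans_le hAB
  have hBA : B - A ≤ K / 2 * δ := by
    rw [hA, hB, ← integral_sub hg hf]
    calc _ ≤ ∫ x, k x / 2 * δ ∂μ :=
          integral_mono (hg.sub hf) ((hk.div_const 2).mul_const δ) hdiff
      _ = _ := by rw [integral_mul_const, integral_div, hK]
  have hAB' : 0 ≤ 1 / A - 1 / B := sub_nonneg.2 (one_div_le_one_div_of_le hA0 hAB)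
  have hpt : ∀ x, |f x / A - g x / B| ≤ (g x - f x) / A + g x * (1 / A - 1 / B) := by
    intro x
    have e : f x / A - g x / B = -((g x - f x) / A) + g x * (1 / A - 1 / B) := by ring
    rw [e]
    refine (abs_add_le _ _).trans ?_
    rw [abs_neg, abs_of_nonneg (div_nonneg (sub_nonneg.2 (hfg x)) hA0.le),
      abs_of_nonneg (mul_nonneg (hg0 x) hAB')]
  have hi1 : Integrable (fun x => (g x - f x) / A) μ := (hg.sub hf).div_const A
  have hi2 : Integrable (fun x => g x * (1 / A - 1 / B)) μ := hg.mul_const _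
  calc ∫ x, |f x / A - g x / B| ∂μ
      ≤ ∫ x, ((g x - f x) / A + g x * (1 / A - 1 / B)) ∂μ :=
        integral_mono ((hf.div_const A).sub (hg.div_const B)).abs (hi1.add hi2) hpt
    _ = (B - A) / A + B * (1 / A - 1 / B) := by
        rw [integral_add hi1 hi2, integral_div, integral_sub hg hf, integral_mul_const]
    _ = (B - A) * 2 / A := by field_simp; ring
    _ ≤ (K / 2 * δ) * 2 / Z0 := by
        have : 0 ≤ B - A := by linarith
        gcongr
    _ = K / (2 * Z0) * (1 + 1) * δ := by field_simp; ring
    _ ≤ K / (2 * Z0) * (1 + Zm / Z0) * δ := by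
        have : 1 ≤ Zm / Z0 := (one_le_div hZ0).2 hZm
        gcongr

/-- the curve `t ↦ π^t` is Lipschitz continuous on `[0, t_max)` in `L¹`
with constant `(K_max/(2 Z_0))(1 + Z_{t_max}/Z_0)`. -/
theorem piCurve_L1_lipschitz
    (F G : EuclideanSpace ℝ (Fin d) → ℝ)
    (hF0 : ∀ x, 0 ≤ F x) (hG0 : ∀ x, 0 ≤ G x)
    (hFdiff : Differentiable ℝ F)
    (hFlip : ∃ L : NNReal, LipschitzWith L (fun x => gradient F x))
    (hloc : LocBdd G) (ρG : ℝ) (hρ : 0 < ρG)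
    (hwc : ConvexOn ℝ Set.univ (fun y => G y + ρG / 2 * ‖y‖ ^ 2))
    (hGint : (∃ L : NNReal, LipschitzWith L G) ∨
      Integrable (fun x : EuclideanSpace ℝ (Fin d) => Real.exp (-G x)))
    (tmax : ℝ) (htmax : tmax ∈ Set.Ioo (0 : ℝ) (1 / ρG))
    (φ : ℝ → ℝ)
    (hφ : ∀ (x p v : EuclideanSpace ℝ (Fin d)) (t : ℝ), 0 < t → t ≤ tmax →
      p ∈ proxSet G t x → v ∈ regSubdiff G p → ‖v‖ ≤ φ ‖x‖)
    (hKint : Integrable (fun x : EuclideanSpace ℝ (Fin d) =>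
      (φ ‖x‖) ^ 2 * Real.exp (-(F x + moreau G tmax x))))
    (hZint : ∀ u ∈ Set.Icc (0 : ℝ) tmax,
      Integrable (fun x : EuclideanSpace ℝ (Fin d) => Real.exp (-(F x + moreau G u x)))) :
    ∀ s ∈ Set.Ico (0 : ℝ) tmax, ∀ t ∈ Set.Ico (0 : ℝ) tmax,
      (∫ x : EuclideanSpace ℝ (Fin d), |piDen F G s x - piDen F G t x|) ≤
        (∫ x : EuclideanSpace ℝ (Fin d),
            (φ ‖x‖) ^ 2 * Real.exp (-(F x + moreau G tmax x))) / (2 * Zfun F G 0) *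
          (1 + Zfun F G tmax / Zfun F G 0) * |s - t| := by
  have hc : Continuous G := by
    have h1 : ContinuousOn (fun y => G y + ρG / 2 * ‖y‖ ^ 2) Set.univ :=
      hwc.continuousOn isOpen_univ
    have h2 := continuousOn_univ.1 h1
    have h3 : Continuous (fun y => (G y + ρG / 2 * ‖y‖ ^ 2) - ρG / 2 * ‖y‖ ^ 2) := by
      exact h2.sub (by fun_prop)
    simpa using h3
  have hC : ∀ x t p, 0 < t → t ≤ tmax → p ∈ proxSet G t x → ‖(1 / t) • (x - p)‖ ≤ φ ‖x‖ :=
    fun x t p h0 h1 hp => hφ x p _ t h0 h1 hp (aux_subgrad G t h0 x p hp)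
  have hmono : ∀ s t x, 0 ≤ s → s ≤ t →
      Real.exp (-(F x + moreau G s x)) ≤ Real.exp (-(F x + moreau G t x)) := by
    intro s t x hs hst
    have := aux_moreau_anti G hG0 hc s t hs hst x
    apply Real.exp_le_exp.2
    linarith
  have hZ0 : 0 < Zfun F G 0 := by
    have := hZint 0 ⟨le_rfl, htmax.1.le⟩
    exact integral_exp_pos this
  have hZmono : ∀ s t, 0 ≤ s → s ≤ t → t ≤ tmax → Zfun F G s ≤ Zfun F G t := by
    intro s t hs hst ht
    exact integral_mono (hZint s ⟨hs, hst.trans ht⟩) (hZint t ⟨hs.trans hst, ht⟩)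
      (fun x => hmono s t x hs hst)
  have main : ∀ s t, 0 ≤ s → s ≤ t → t < tmax →
      (∫ x : EuclideanSpace ℝ (Fin d), |piDen F G s x - piDen F G t x|) ≤
        (∫ x : EuclideanSpace ℝ (Fin d),
            (φ ‖x‖) ^ 2 * Real.exp (-(F x + moreau G tmax x))) / (2 * Zfun F G 0) *
          (1 + Zfun F G tmax / Zfun F G 0) * (t - s) := by
    intro s t hs hst ht
    refine aux_main volume (fun x => Real.exp (-(F x + moreau G s x)))
      (fun x => Real.exp (-(F x + moreau G t x)))
      (fun x => (φ ‖x‖) ^ 2 * Real.exp (-(F x + moreau G tmax x))) (t - s) _ _ _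
      (hZint s ⟨hs, hst.trans ht.le⟩) (hZint t ⟨hs.trans hst, ht.le⟩) hKint
      (fun x => (Real.exp_pos _).le) (fun x => hmono s t x hs hst) ?_ rfl
      (integral_nonneg fun x => by positivity) (by linarith) hZ0
      (hZmono 0 s le_rfl hs (hst.trans ht.le)) (hZmono 0 tmax le_rfl htmax.1.le le_rfl)
    intro x
    have h1 := aux_lip G hG0 hc tmax x (φ ‖x‖) (hC x) s t hs hst ht.le
    have h2 := hmono t tmax x (hs.trans hst) ht.le
    set a := moreau G s x
    set b := moreau G t x
    have e : Real.exp (-(F x + a)) = Real.exp (-(F x + b)) * Real.exp (-(a - b)) := by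
      rw [← Real.exp_add]; congr 1; ring
    have h3 := Real.add_one_le_exp (-(a - b))
    have hp := Real.exp_pos (-(F x + b))
    have h4 : 0 ≤ (φ ‖x‖) ^ 2 / 2 * (t - s) := mul_nonneg (by positivity) (by linarith)
    calc Real.exp (-(F x + b)) - Real.exp (-(F x + a))
        = Real.exp (-(F x + b)) * (1 - Real.exp (-(a - b))) := by rw [e]; ring
      _ ≤ Real.exp (-(F x + b)) * ((φ ‖x‖) ^ 2 / 2 * (t - s)) := by
          apply mul_le_mul_of_nonneg_left _ hp.le
          linarith
      _ ≤ Real.exp (-(F x + moreau G tmax x)) * ((φ ‖x‖) ^ 2 / 2 * (t - s)) :=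
          mul_le_mul_of_nonneg_right h2 h4
      _ = _ := by ring
  intro s hs t ht
  rcases le_total s t with h | h
  · rw [abs_sub_comm, abs_of_nonneg (by linarith : 0 ≤ t - s)]
    exact main s t hs.1 h ht.2
  · rw [abs_of_nonneg (by linarith : 0 ≤ s - t)]
    have := main t s ht.1 h hs.2
    simpa only [abs_sub_comm] using this
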